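/- Let p be prime, n ≥ 1, m ≥ 1, let α, α₁, …, α_m be real numbers, let λ, λ₁, …, λ_m > 0, and let 1 < r, r₁, …, r_m, q, q₁, …, q_m < ∞ satisfy α₁ + ⋯ + α_m = α, 1/r₁ + ⋯ + 1/r_m = 1/r, 1/q₁ + ⋯ + 1/q_m = 1/q, and λ₁ + ⋯ + λ_m = λ. Let ψ be a nonnegative measurable function on (ℤ_p^*)^m and set C = ∫_{(ℤ_p^*)^m} |t₁|_p^{-(α₁+n/q₁−λ₁)} ⋯ |t_m|_p^{-(α_m+n/q_m−λ_m)} ψ(t₁,…,t_m) dt₁⋯dt_m. If C < ∞, then for all nonnegative measurable functions f₁, …, f_m on ℚ_p^n one has ‖H^{p,m}_ψ(f₁,…,f_m)‖_{MK̇^{α,λ}_{r,q}} ≤ C · ∏_{i=1}^m ‖f_i‖_{MK̇^{α_i,λ_i}_{r_i,q_i}}; in particular H^{p,m}_ψ is bounded from MK̇^{α₁,λ₁}_{r₁,q₁}(ℚ_p^n) × ⋯ × MK̇^{α_m,λ_m}_{r_m,q_m}(ℚ_p^n) to MK̇^{α,λ}_{r,q}(ℚ_p^n) with operator norm at most C.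 -/

import Mathlib

open MeasureTheory
open scoped ENNReal

noncomputable section

variable (p : ℕ) [Fact p.Prime]

instance padicMeasurableSpace : MeasurableSpace ℚ_[p] := borel _
instance padicBorelSpace : BorelSpace ℚ_[p] := ⟨rfl⟩

/-- The closed unit ball of `ℚ_[p]` as a positive compact set. -/
def padicUnitBall : TopologicalSpace.PositiveCompacts ℚ_[p] where
  carrier := Metric.closedBall 0 1
  isCompact' := isCompact_closedBall 0 1
  interior_nonempty' :=
    ⟨0, mem_interior_iff_mem_nhds.mpr
      (Filter.mem_of_superset (Metric.ball_mem_nhds 0 one_pos) Metric.ball_subset_closedBall)⟩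

/-- Haar measure on `ℚ_[p]` normalized so that `ℤ_p` has measure 1. -/
def padicHaar : Measure ℚ_[p] := Measure.addHaarMeasure (padicUnitBall p)

instance : SigmaFinite (padicHaar p) := by
  unfold padicHaar; infer_instance

/-- Normalized Haar measure on `ℚ_[p]^n` (the product measure), for which the
unit ball has measure 1. -/
def padicHaarPi (n : ℕ) : Measure (Fin n → ℚ_[p]) := Measure.pi fun _ => padicHaar p

/-- `ℤ_p^* = {t : 0 < |t|_p ≤ 1}`. -/
def Zpstar : Set ℚ_[p] := {t | t ≠ 0 ∧ ‖t‖ ≤ 1}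

/-- `(ℤ_p^*)^m`. -/
def ZpstarPi (m : ℕ) : Set (Fin m → ℚ_[p]) := Set.univ.pi fun _ => Zpstar p

/-- The sphere `S_k = {x ∈ ℚ_p^n : |x|_p = p^k}`. -/
def padicSphere (n : ℕ) (k : ℤ) : Set (Fin n → ℚ_[p]) := {x | ‖x‖ = (p : ℝ) ^ k}

/-- `‖f χ_k‖_{L^q}` for a nonnegative (ℝ≥0∞-valued) function. -/
def lqNormSphere (n : ℕ) (q : ℝ) (k : ℤ) (f : (Fin n → ℚ_[p]) → ℝ≥0∞) : ℝ≥0∞ :=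
  (∫⁻ x in padicSphere p n k, f x ^ q ∂ padicHaarPi p n) ^ (1 / q)

/-- The homogeneous p-adic Herz norm `‖f‖_{K̇^{α,r}_q}`. -/
def herzNorm (n : ℕ) (α r q : ℝ) (f : (Fin n → ℚ_[p]) → ℝ≥0∞) : ℝ≥0∞ :=
  (∑' k : ℤ, (p : ℝ≥0∞) ^ ((k : ℝ) * α * r) * lqNormSphere p n q k f ^ r) ^ (1 / r)

/-- The homogeneous p-adic Morrey–Herz norm `‖f‖_{MK̇^{α,λ}_{r,q}}`. -/
def morreyHerzNorm (n : ℕ) (α lam r q : ℝ) (f : (Fin n → ℚ_[p]) → ℝ≥0∞) : ℝ≥0∞ :=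
  ⨆ k₀ : ℤ, (p : ℝ≥0∞) ^ (-(k₀ : ℝ) * lam) *
    (∑' k : {k : ℤ // k ≤ k₀},
      (p : ℝ≥0∞) ^ (((k : ℤ) : ℝ) * α * r) * lqNormSphere p n q (k : ℤ) f ^ r) ^ (1 / r)

/-- The weighted multilinear p-adic Hardy operator `H^{p,m}_ψ`. -/
def multilinearHardy (n m : ℕ) (ψ : (Fin m → ℚ_[p]) → ℝ≥0∞)
    (f : Fin m → (Fin n → ℚ_[p]) → ℝ≥0∞) (x : Fin n → ℚ_[p]) : ℝ≥0∞ :=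
  ∫⁻ t in ZpstarPi p m, (∏ i, f i (t i • x)) * ψ t ∂ padicHaarPi p m

/-- The dual weighted multilinear p-adic Hardy operator `H^{p,m,*}_ψ`. -/
def multilinearHardyDual (n m : ℕ) (ψ : (Fin m → ℚ_[p]) → ℝ≥0∞)
    (f : Fin m → (Fin n → ℚ_[p]) → ℝ≥0∞) (x : Fin n → ℚ_[p]) : ℝ≥0∞ :=
  ∫⁻ t in ZpstarPi p m,
      (∏ i, f i ((((padicNormE (t i) : ℚ)⁻¹ : ℚ_[p])) • x)) *
        (∏ i, ENNReal.ofReal ‖t i‖ ^ (-(n : ℝ))) * ψ t ∂ padicHaarPi p m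


theorem lintegral_rpow_lintegral_le {X T : Type*} [MeasurableSpace X] [MeasurableSpace T]
    (μ : Measure X) [SigmaFinite μ] (ν : Measure T) [SFinite ν] {q : ℝ} (hq : 1 < q)
    {F : X → T → ℝ≥0∞} (hF : Measurable (Function.uncurry F)) :
    (∫⁻ x, (∫⁻ t, F x t ∂ν) ^ q ∂μ) ^ (1 / q) ≤
      ∫⁻ t, (∫⁻ x, F x t ^ q ∂μ) ^ (1 / q) ∂ν := by
  have hq0 : 0 < q := by linarith
  have hconj := Real.HolderConjugate.conjExponent hq
  set q' := q.conjExponent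
  set R := ∫⁻ t, (∫⁻ x, F x t ^ q ∂μ) ^ (1 / q) ∂ν
  set G : X → ℝ≥0∞ := fun x => ∫⁻ t, F x t ∂ν
  have hGm : Measurable G := hF.lintegral_prod_right'
  have key : ∀ g : X → ℝ≥0∞, Measurable g → (∀ x, g x ≤ G x) → ∫⁻ x, g x ^ q ∂μ ≠ ⊤ →
      ∫⁻ x, g x ^ q ∂μ ≤ R ^ q := by
    intro g hg hgG hfin
    set I := ∫⁻ x, g x ^ q ∂μ
    rcases eq_or_ne I 0 with h0 | h0
    · simp [h0]
    have h1 : I ≤ I ^ (1 / q') * R := by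
      calc I ≤ ∫⁻ x, g x ^ (q - 1) * G x ∂μ := by
            refine lintegral_mono fun x => ?_
            calc g x ^ q = g x ^ (q - 1) * g x := by
                  conv_lhs => rw [show q = (q - 1) + 1 by ring,
                    ENNReal.rpow_add_of_nonneg _ _ (by linarith) zero_le_one, ENNReal.rpow_one]
              _ ≤ _ := by gcongr; exact hgG x
        _ = ∫⁻ x, ∫⁻ t, g x ^ (q - 1) * F x t ∂ν ∂μ := by
            refine lintegral_congr fun x => ?_
            exact (lintegral_const_mul _ (hF.comp measurable_prodMk_left)).symm
        _ = ∫⁻ t, ∫⁻ x, g x ^ (q - 1) * F x t ∂μ ∂ν := by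
            refine lintegral_lintegral_swap (Measurable.aemeasurable ?_)
            exact ((hg.comp measurable_fst).pow_const _).mul hF
        _ ≤ ∫⁻ t, I ^ (1 / q') * (∫⁻ x, F x t ^ q ∂μ) ^ (1 / q) ∂ν := by
            refine lintegral_mono fun t => ?_
            have := ENNReal.lintegral_mul_le_Lp_mul_Lq μ hconj.symm
              (f := fun x => g x ^ (q - 1)) (g := fun x => F x t)
              (hg.pow_const _).aemeasurable (hF.comp measurable_prodMk_right).aemeasurable
            refine this.trans_eq ?_
            congr 2
            refine lintegral_congr fun x => ?_
            rw [← ENNReal.rpow_mul, hconj.sub_one_mul_conj]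
        _ = I ^ (1 / q') * R := by
            rw [lintegral_const_mul]
            refine Measurable.pow_const ?_ _
            exact (hF.pow_const q).lintegral_prod_left'
    have h2 : I = I ^ (1 / q') * I ^ (1 / q) := by
      rw [← ENNReal.rpow_add _ _ h0 hfin, one_div, one_div, add_comm,
        hconj.inv_add_inv_eq_one, ENNReal.rpow_one]
    have h3 : I ^ (1 / q) ≤ R := by
      have hne : I ^ (1 / q') ≠ 0 := by simp [ENNReal.rpow_eq_zero_iff, h0, hfin]
      have hnt : I ^ (1 / q') ≠ ⊤ := by simp [ENNReal.rpow_eq_top_iff, h0, hfin]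
      exact (ENNReal.mul_le_mul_iff_right hne hnt).1 (h2.symm.trans_le h1)
    calc I = (I ^ (1 / q)) ^ q := by
          rw [← ENNReal.rpow_mul, one_div_mul_cancel hq0.ne', ENNReal.rpow_one]
      _ ≤ R ^ q := by gcongr
  rw [one_div, ENNReal.rpow_inv_le_iff hq0]
  set g : ℕ → X → ℝ≥0∞ := fun N => (spanningSets μ N).indicator fun x => min (G x) N with hg
  have hgm : ∀ N, Measurable (g N) := fun N =>
    (hGm.min measurable_const).indicator (measurableSet_spanningSets μ N)
  have hmono : Monotone g := by
    intro M N hMN x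
    refine (Set.indicator_le_indicator_of_subset (monotone_spanningSets μ hMN)
      (fun _ => zero_le) x).trans ?_
    refine Set.indicator_le_indicator ?_
    gcongr
  have hsup : ∀ x, G x ^ q = ⨆ N, g N x ^ q := by
    intro x
    refine le_antisymm ?_ (iSup_le fun N => ?_)
    · refine le_of_forall_lt fun c hc => ?_
      have hc' : c ^ q⁻¹ < G x := (ENNReal.rpow_inv_lt_iff hq0).2 hc
      obtain ⟨N, hN⟩ := ENNReal.exists_nat_gt (ne_top_of_lt hc')
      have hx : x ∈ spanningSets μ (max N (spanningSetsIndex μ x)) :=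
        monotone_spanningSets μ (le_max_right _ _) (mem_spanningSetsIndex μ x)
      refine lt_of_lt_of_le ?_ (le_iSup _ (max N (spanningSetsIndex μ x)))
      rw [← ENNReal.rpow_inv_lt_iff hq0]
      simp only [hg, Set.indicator_of_mem hx]
      refine lt_min hc' (hN.trans_le ?_)
      exact_mod_cast le_max_left _ _
    · gcongr
      exact Set.indicator_le' (fun _ _ => min_le_left _ _) (fun _ _ => zero_le) x
  calc ∫⁻ x, G x ^ q ∂μ = ∫⁻ x, ⨆ N, g N x ^ q ∂μ := lintegral_congr hsup
    _ = ⨆ N, ∫⁻ x, g N x ^ q ∂μ := by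
        refine lintegral_iSup (fun N => (hgm N).pow_const q) fun M N h x => ?_
        dsimp only
        gcongr
        exact hmono h x
    _ ≤ R ^ q := by
        refine iSup_le fun N => key _ (hgm N) (fun x => ?_) (ne_top_of_le_ne_top ?_ (lintegral_mono
          (g := (spanningSets μ N).indicator fun _ => (N : ℝ≥0∞) ^ q) fun x => ?_))
        · exact Set.indicator_le' (fun _ _ => min_le_left _ _) (fun _ _ => zero_le) x
        · rw [lintegral_indicator_const (measurableSet_spanningSets μ N)]
          exact ENNReal.mul_ne_top (ENNReal.rpow_ne_top_of_nonneg hq0.le (by simp))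
            (measure_spanningSets_lt_top μ N).ne
        · by_cases hx : x ∈ spanningSets μ N
          · simp only [hg, Set.indicator_of_mem hx]
            gcongr
            exact min_le_right _ _
          · simp [hg, hx, hq0]

theorem lintegral_prod_rpow_le {X : Type*} [MeasurableSpace X] (μ : Measure X) {m : ℕ} {q : ℝ}
    {qi : Fin m → ℝ} (hq : 0 < q) (hqi : ∀ i, 0 < qi i) (hsum : ∑ i, (qi i)⁻¹ = q⁻¹)
    {G : Fin m → X → ℝ≥0∞} (hG : ∀ i, Measurable (G i)) :
    (∫⁻ x, (∏ i, G i x) ^ q ∂μ) ^ (1 / q) ≤ ∏ i, (∫⁻ x, G i x ^ qi i ∂μ) ^ (1 / qi i) := by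
  have h := ENNReal.lintegral_prod_norm_pow_le (μ := μ) Finset.univ
    (f := fun i x => G i x ^ qi i) (p := fun i => q / qi i)
    (fun i _ => ((hG i).pow_const _).aemeasurable)
    (by simp_rw [div_eq_mul_inv, ← Finset.mul_sum, hsum, mul_inv_cancel₀ hq.ne'])
    (fun i _ => (div_pos hq (hqi i)).le)
  rw [one_div, ENNReal.rpow_inv_le_iff hq, ← ENNReal.prod_rpow_of_nonneg hq.le]
  simp_rw [← ENNReal.prod_rpow_of_nonneg hq.le]
  refine (lintegral_congr fun x => Finset.prod_congr rfl fun i _ => ?_).trans_le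
    (h.trans_eq (Finset.prod_congr rfl fun i _ => ?_))
  · rw [← ENNReal.rpow_mul, mul_div_cancel₀ _ (hqi i).ne']
  · rw [← ENNReal.rpow_mul, one_div_mul_eq_div]

theorem lintegral_rpow_lintegral_prod_le {X T : Type*} [MeasurableSpace X] [MeasurableSpace T]
    (μ : Measure X) [SigmaFinite μ] (ν : Measure T) [SFinite ν] {m : ℕ} {q : ℝ} {qi : Fin m → ℝ}
    (hq : 1 < q) (hqi : ∀ i, 0 < qi i) (hsum : ∑ i, (qi i)⁻¹ = q⁻¹)
    {G : Fin m → X → T → ℝ≥0∞} (hG : ∀ i, Measurable (Function.uncurry (G i)))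
    {ψ : T → ℝ≥0∞} (hψ : Measurable ψ) :
    (∫⁻ x, (∫⁻ t, (∏ i, G i x t) * ψ t ∂ν) ^ q ∂μ) ^ (1 / q) ≤
      ∫⁻ t, (∏ i, (∫⁻ x, G i x t ^ qi i ∂μ) ^ (1 / qi i)) * ψ t ∂ν := by
  have hq0 : 0 < q := by linarith
  have hm : Measurable (Function.uncurry fun x t => ∏ i, G i x t) :=
    Finset.measurable_fun_prod _ fun i _ => hG i
  refine (lintegral_rpow_lintegral_le μ ν hq (F := fun x t => (∏ i, G i x t) * ψ t)
    (hm.mul (hψ.comp measurable_snd))).trans ?_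
  refine lintegral_mono fun t => ?_
  have hmt : Measurable fun x => ∏ i, G i x t := hm.comp measurable_prodMk_right
  simp_rw [ENNReal.mul_rpow_of_nonneg _ _ hq0.le]
  rw [lintegral_mul_const _ (hmt.pow_const q),
    ENNReal.mul_rpow_of_nonneg _ _ (one_div_nonneg.2 hq0.le), ← ENNReal.rpow_mul,
    mul_one_div_cancel hq0.ne', ENNReal.rpow_one]
  gcongr
  exact lintegral_prod_rpow_le μ hq0 hqi hsum fun i => (hG i).comp measurable_prodMk_right

theorem padicHaar_closedBall_one : padicHaar p (Metric.closedBall 0 1) = 1 :=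
  Measure.addHaarMeasure_self (K₀ := padicUnitBall p)

instance : (padicHaar p).IsAddHaarMeasure := by
  unfold padicHaar; infer_instance

theorem closedBall_one_eq_iUnion_ball :
    Metric.closedBall (0 : ℚ_[p]) 1 = ⋃ j ∈ Finset.range p, Metric.ball (j : ℚ_[p]) 1 := by
  ext x
  rw [mem_closedBall_zero_iff]
  simp only [Set.mem_iUnion, Metric.mem_ball, Finset.mem_range, exists_prop, dist_eq_norm]
  constructor
  · intro hx
    obtain ⟨j, hj, hxj⟩ := PadicInt.exists_mem_range (⟨x, hx⟩ : ℤ_[p])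
    refine ⟨j, hj, ?_⟩
    rw [IsLocalRing.mem_maximalIdeal, PadicInt.mem_nonunits] at hxj
    rw [PadicInt.norm_def] at hxj
    exact_mod_cast hxj
  · rintro ⟨j, -, hxj⟩
    have hj : ‖(j : ℚ_[p])‖ ≤ 1 := by simpa using Padic.norm_int_le_one (p := p) j
    calc ‖x‖ = ‖(x - j) + j‖ := by ring_nf
      _ ≤ max ‖x - j‖ ‖(j : ℚ_[p])‖ := Padic.nonarchimedean _ _
      _ ≤ 1 := max_le hxj.le hj

theorem pairwiseDisjoint_ball_natCast :
    ((Finset.range p : Finset ℕ) : Set ℕ).PairwiseDisjoint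
      fun j => Metric.ball (j : ℚ_[p]) 1 := by
  intro i hi j hj hij
  refine (IsUltrametricDist.ball_eq_or_disjoint (i : ℚ_[p]) j 1).resolve_left fun h => hij ?_
  have hmem : (i : ℚ_[p]) ∈ Metric.ball (j : ℚ_[p]) 1 := h ▸ Metric.mem_ball_self one_pos
  rw [Metric.mem_ball, dist_eq_norm] at hmem
  have hdvd : (p : ℤ) ∣ (i : ℤ) - j := by
    rw [← Padic.norm_intCast_lt_one_iff]
    push_cast
    exact hmem
  simp only [Finset.coe_range, Set.mem_Iio] at hi hj
  have := Int.eq_zero_of_abs_lt_dvd hdvd (by rw [abs_lt]; omega)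
  omega

theorem natCast_mul_padicHaar_ball_one : (p : ℝ≥0∞) * padicHaar p (Metric.ball 0 1) = 1 := by
  rw [← padicHaar_closedBall_one p, closedBall_one_eq_iUnion_ball,
    measure_biUnion_finset (pairwiseDisjoint_ball_natCast p) fun _ _ => measurableSet_ball]
  have h : ∀ j ∈ Finset.range p,
      padicHaar p (Metric.ball (j : ℚ_[p]) 1) = padicHaar p (Metric.ball 0 1) := fun j _ => by
    simpa using (Measure.addHaar_ball_center (padicHaar p) (j : ℚ_[p]) 1)
  rw [Finset.sum_congr rfl h]
  simp

theorem map_mul_left_padicHaar_eq_smul {t : ℚ_[p]} (ht : t ≠ 0) :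
    (padicHaar p).map (t * ·) = padicHaar p (Metric.closedBall 0 ‖t‖⁻¹) • padicHaar p := by
  have e : (padicHaar p).map (t * ·) =
      (padicHaar p).map (LinearEquiv.smulOfNeZero ℚ_[p] ℚ_[p] t ht) := rfl
  have : ((padicHaar p).map (t * ·)).IsAddHaarMeasure := by
    rw [e]; exact Measure.MapLinearEquiv.isAddHaarMeasure _ _
  have h := Measure.addHaarMeasure_unique ((padicHaar p).map (t * ·)) (padicUnitBall p)
  rw [h]
  congr 1
  have hc : ((padicUnitBall p : TopologicalSpace.PositiveCompacts ℚ_[p]) : Set ℚ_[p]) =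
      Metric.closedBall 0 1 := rfl
  rw [hc, Measure.map_apply (measurable_const_mul t) measurableSet_closedBall]
  congr 1
  ext x
  have : 0 < ‖t‖ := norm_pos_iff.2 ht
  simp only [Set.mem_preimage, Metric.mem_closedBall, dist_zero_right, norm_mul]
  rw [inv_eq_one_div, le_div_iff₀ this, mul_comm]

theorem padicHaar_closedBall_zpow_add_one (k : ℤ) :
    padicHaar p (Metric.closedBall 0 ((p : ℝ) ^ (k + 1))) =
      p * padicHaar p (Metric.closedBall 0 ((p : ℝ) ^ k)) := by
  have hp0 : (0 : ℝ) < p := by exact_mod_cast (Fact.out : p.Prime).pos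
  have hpne : (p : ℚ_[p]) ≠ 0 := by exact_mod_cast (Fact.out : p.Prime).ne_zero
  have hscale : ∀ s : Set ℚ_[p], MeasurableSet s → padicHaar p (((p : ℚ_[p]) * ·) ⁻¹' s) =
      padicHaar p (Metric.closedBall 0 (p : ℝ)) * padicHaar p s := fun s hs => by
    rw [← Measure.map_apply (measurable_const_mul _) hs, map_mul_left_padicHaar_eq_smul p hpne]
    simp [Padic.norm_p]
  have hball : ((p : ℚ_[p]) * ·) ⁻¹' Metric.ball 0 1 = Metric.ball 0 (p : ℝ) := by
    ext x
    simp [Padic.norm_p, inv_mul_lt_iff₀ hp0]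
  have hclosed : ∀ r : ℝ, ((p : ℚ_[p]) * ·) ⁻¹' Metric.closedBall 0 r =
      Metric.closedBall 0 (p * r) := fun r => by
    ext x
    simp [Padic.norm_p, inv_mul_le_iff₀ hp0]
  have hb : Metric.ball (0 : ℚ_[p]) (p : ℝ) = Metric.closedBall 0 1 := by
    ext x
    have := Padic.norm_le_pow_iff_norm_lt_pow_add_one x 0
    simpa using this.symm
  have h1 := hscale _ (measurableSet_ball (x := 0) (ε := 1))
  rw [hball, hb, padicHaar_closedBall_one] at h1
  have h2 : padicHaar p (Metric.closedBall 0 (p : ℝ)) = p := by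
    have h3 := natCast_mul_padicHaar_ball_one p
    rw [ENNReal.eq_inv_of_mul_eq_one_left h1.symm, ENNReal.eq_inv_of_mul_eq_one_left h3]
  rw [zpow_add_one₀ hp0.ne', mul_comm, ← hclosed, hscale _ measurableSet_closedBall, h2]

theorem padicHaar_closedBall_zpow (k : ℤ) :
    padicHaar p (Metric.closedBall 0 ((p : ℝ) ^ k)) = (p : ℝ≥0∞) ^ k := by
  have hpE : (p : ℝ≥0∞) ≠ 0 := by exact_mod_cast (Fact.out : p.Prime).ne_zero
  have hpT : (p : ℝ≥0∞) ≠ ⊤ := ENNReal.natCast_ne_top p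
  induction k using Int.induction_on with
  | zero => simpa using padicHaar_closedBall_one p
  | succ k ih =>
    rw [padicHaar_closedBall_zpow_add_one, ih, ENNReal.zpow_add hpE hpT, zpow_one, mul_comm]
  | pred k ih =>
    have h := padicHaar_closedBall_zpow_add_one p (-(k : ℤ) - 1)
    rw [sub_add_cancel, ih] at h
    rw [← ENNReal.mul_right_inj hpE hpT, ← h]
    conv_lhs => rw [show -(k : ℤ) = 1 + (-k - 1) by ring, ENNReal.zpow_add hpE hpT, zpow_one]

theorem map_smul_padicHaarPi (n : ℕ) {t : ℚ_[p]} (ht : t ≠ 0) {l : ℤ} (hl : ‖t‖ = (p : ℝ) ^ l) :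
    (padicHaarPi p n).map (t • ·) = ((p : ℝ≥0∞) ^ (-l)) ^ n • padicHaarPi p n := by
  have hpE : (p : ℝ≥0∞) ≠ 0 := by exact_mod_cast (Fact.out : p.Prime).ne_zero
  have hpT : (p : ℝ≥0∞) ≠ ⊤ := ENNReal.natCast_ne_top p
  have h1 : (padicHaar p).map (t * ·) = (p : ℝ≥0∞) ^ (-l) • padicHaar p := by
    rw [map_mul_left_padicHaar_eq_smul p ht, hl, ← zpow_neg, padicHaar_closedBall_zpow]
  have hfin : (p : ℝ≥0∞) ^ (-l) ≠ ⊤ := ENNReal.zpow_ne_top hpE hpT _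
  have : SigmaFinite ((padicHaar p).map (t * ·)) := by
    rw [h1, ← ENNReal.coe_toNNReal hfin]
    exact inferInstanceAs (SigmaFinite (((p : ℝ≥0∞) ^ (-l)).toNNReal • padicHaar p))
  unfold padicHaarPi
  have h2 := Measure.pi_map_pi (μ := fun _ : Fin n => padicHaar p) (f := fun _ x => t * x)
    fun _ => (measurable_const_mul t).aemeasurable
  refine h2.trans (Measure.pi_eq fun s hs => ?_)
  rw [h1]
  simp [Measure.pi_pi, Finset.prod_mul_distrib]

instance (n : ℕ) : SigmaFinite (padicHaarPi p n) := by
  unfold padicHaarPi; infer_instance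

theorem measurableSet_padicSphere (n : ℕ) (k : ℤ) : MeasurableSet (padicSphere p n k) :=
  measurableSet_eq_fun measurable_norm measurable_const

theorem lqNormSphere_comp_smul {n : ℕ} {q : ℝ} (hq : 0 < q) (k : ℤ) {t : ℚ_[p]} (ht : t ≠ 0)
    {l : ℤ} (hl : ‖t‖ = (p : ℝ) ^ l) {f : (Fin n → ℚ_[p]) → ℝ≥0∞} (hf : Measurable f) :
    lqNormSphere p n q k (fun x => f (t • x)) =
      (p : ℝ≥0∞) ^ (-(l * (n / q)) : ℝ) * lqNormSphere p n q (k + l) f := by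
  have hp0 : (0 : ℝ) < p := by exact_mod_cast (Fact.out : p.Prime).pos
  have hsphere : (t • ·) ⁻¹' padicSphere p n (k + l) = padicSphere p n k := by
    ext x
    simp only [padicSphere, Set.mem_preimage, Set.mem_ofPred_eq, norm_smul, hl, zpow_add₀ hp0.ne',
      mul_comm ((p : ℝ) ^ k)]
    exact mul_right_inj' (zpow_pos hp0 l).ne'
  have hint : ∫⁻ x in padicSphere p n k, f (t • x) ^ q ∂padicHaarPi p n =
      ((p : ℝ≥0∞) ^ (-l)) ^ n * ∫⁻ x in padicSphere p n (k + l), f x ^ q ∂padicHaarPi p n := by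
    rw [← hsphere, ← setLIntegral_map (measurableSet_padicSphere p n (k + l)) (hf.pow_const q)
      (measurable_const_smul t), map_smul_padicHaarPi p n ht hl, Measure.restrict_smul,
      lintegral_smul_measure, smul_eq_mul]
  rw [lqNormSphere, hint, ENNReal.mul_rpow_of_nonneg _ _ (one_div_nonneg.2 hq.le), lqNormSphere]
  congr 1
  rw [← ENNReal.rpow_natCast, ← ENNReal.rpow_intCast, ← ENNReal.rpow_mul, ← ENNReal.rpow_mul]
  congr 1
  push_cast
  ring

theorem rpow_mul_tsum_le_morreyHerzNorm (n : ℕ) (α lam r q : ℝ) (f : (Fin n → ℚ_[p]) → ℝ≥0∞)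
    (k₀ : ℤ) :
    (∑' k : {k : ℤ // k ≤ k₀},
      (p : ℝ≥0∞) ^ (((k : ℤ) : ℝ) * α * r) * lqNormSphere p n q (k : ℤ) f ^ r) ^ (1 / r) ≤
      (p : ℝ≥0∞) ^ ((k₀ : ℝ) * lam) * morreyHerzNorm p n α lam r q f := by
  have hpE : (p : ℝ≥0∞) ≠ 0 := by exact_mod_cast (Fact.out : p.Prime).ne_zero
  have hpT : (p : ℝ≥0∞) ≠ ⊤ := ENNReal.natCast_ne_top p
  have h : (p : ℝ≥0∞) ^ (-(k₀ : ℝ) * lam) * _ ≤ morreyHerzNorm p n α lam r q f :=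
    le_iSup (fun k₀ : ℤ => (p : ℝ≥0∞) ^ (-(k₀ : ℝ) * lam) *
    (∑' k : {k : ℤ // k ≤ k₀},
      (p : ℝ≥0∞) ^ (((k : ℤ) : ℝ) * α * r) * lqNormSphere p n q (k : ℤ) f ^ r) ^ (1 / r)) k₀
  refine le_trans (le_of_eq ?_) (mul_le_mul_right h ((p : ℝ≥0∞) ^ ((k₀ : ℝ) * lam)))
  rw [← mul_assoc, ← ENNReal.rpow_add _ _ hpE hpT]
  simp

theorem tsum_lqNormSphere_comp_smul_le {n : ℕ} {α lam r q : ℝ} (hr : 0 < r) (hq : 0 < q)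
    (k₀ : ℤ) {t : ℚ_[p]} (ht : t ≠ 0) {f : (Fin n → ℚ_[p]) → ℝ≥0∞} (hf : Measurable f) :
    (∑' k : {k : ℤ // k ≤ k₀}, ((p : ℝ≥0∞) ^ (((k : ℤ) : ℝ) * α) *
        lqNormSphere p n q (k : ℤ) (fun x => f (t • x))) ^ r) ^ (1 / r) ≤
      ENNReal.ofReal ‖t‖ ^ (-(α + (n : ℝ) / q - lam)) *
        ((p : ℝ≥0∞) ^ ((k₀ : ℝ) * lam) * morreyHerzNorm p n α lam r q f) := by
  have hp0 : (0 : ℝ) < p := by exact_mod_cast (Fact.out : p.Prime).pos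
  have hpE : (p : ℝ≥0∞) ≠ 0 := by exact_mod_cast (Fact.out : p.Prime).ne_zero
  have hpT : (p : ℝ≥0∞) ≠ ⊤ := ENNReal.natCast_ne_top p
  obtain ⟨l, hl⟩ : ∃ l : ℤ, ‖t‖ = (p : ℝ) ^ l := ⟨_, Padic.norm_eq_zpow_neg_valuation ht⟩
  have hnorm : ENNReal.ofReal ‖t‖ = (p : ℝ≥0∞) ^ (l : ℝ) := by
    rw [hl, ← Real.rpow_intCast, ← ENNReal.ofReal_rpow_of_pos hp0, ENNReal.ofReal_natCast]
  let e : {k : ℤ // k ≤ k₀} ≃ {k : ℤ // k ≤ k₀ + l} :=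
    (Equiv.addRight l).subtypeEquiv fun k => by simp
  have hterm : ∀ k : {k : ℤ // k ≤ k₀}, ((p : ℝ≥0∞) ^ (((k : ℤ) : ℝ) * α) *
        lqNormSphere p n q (k : ℤ) (fun x => f (t • x))) ^ r =
      ((p : ℝ≥0∞) ^ (-(l * (α + n / q)) : ℝ)) ^ r *
        ((p : ℝ≥0∞) ^ (((e k : ℤ) : ℝ) * α * r) * lqNormSphere p n q (e k : ℤ) f ^ r) := by
    intro k
    have he : (e k : ℤ) = k + l := rfl
    rw [lqNormSphere_comp_smul p hq k ht hl hf, he, ENNReal.rpow_mul _ _ r,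
      ← ENNReal.mul_rpow_of_nonneg _ _ hr.le, ← ENNReal.mul_rpow_of_nonneg _ _ hr.le,
      ← mul_assoc, ← mul_assoc, ← ENNReal.rpow_add _ _ hpE hpT, ← ENNReal.rpow_add _ _ hpE hpT]
    congr 3
    push_cast
    ring
  rw [tsum_congr hterm, ENNReal.tsum_mul_left, e.tsum_eq (fun k : {k : ℤ // k ≤ k₀ + l} =>
      (p : ℝ≥0∞) ^ (((k : ℤ) : ℝ) * α * r) * lqNormSphere p n q (k : ℤ) f ^ r),
    ENNReal.mul_rpow_of_nonneg _ _ (one_div_nonneg.2 hr.le), ← ENNReal.rpow_mul,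
    mul_one_div_cancel hr.ne', ENNReal.rpow_one]
  refine (mul_le_mul_right (rpow_mul_tsum_le_morreyHerzNorm p n α lam r q f (k₀ + l)) _).trans_eq ?_
  rw [hnorm, ← ENNReal.rpow_mul, ← mul_assoc, ← mul_assoc, ← ENNReal.rpow_add _ _ hpE hpT,
    ← ENNReal.rpow_add _ _ hpE hpT]
  congr 2
  push_cast
  ring

theorem measurable_uncurry_comp_smul {n m : ℕ} (i : Fin m) {f : (Fin n → ℚ_[p]) → ℝ≥0∞}
    (hf : Measurable f) :
    Measurable (Function.uncurry fun (x : Fin n → ℚ_[p]) (t : Fin m → ℚ_[p]) => f (t i • x)) := by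
  refine hf.comp (measurable_pi_lambda _ fun j => ?_)
  exact ((measurable_pi_apply i).comp measurable_snd).mul
    ((measurable_pi_apply j).comp measurable_fst)

theorem measurable_lqNormSphere_comp_smul {n m : ℕ} (q : ℝ) (k : ℤ) (i : Fin m)
    {f : (Fin n → ℚ_[p]) → ℝ≥0∞} (hf : Measurable f) :
    Measurable fun t : Fin m → ℚ_[p] => lqNormSphere p n q k (fun x => f (t i • x)) :=
  (Measurable.lintegral_prod_left' ((measurable_uncurry_comp_smul p i hf).pow_const q)).pow_const _

theorem lqNormSphere_multilinearHardy_le {n m : ℕ} {q : ℝ} {qi : Fin m → ℝ} (hq : 1 < q)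
    (hqi : ∀ i, 0 < qi i) (hqsum : ∑ i, (qi i)⁻¹ = q⁻¹) {ψ : (Fin m → ℚ_[p]) → ℝ≥0∞}
    (hψ : Measurable ψ) {f : Fin m → (Fin n → ℚ_[p]) → ℝ≥0∞} (hf : ∀ i, Measurable (f i))
    (k : ℤ) :
    lqNormSphere p n q k (multilinearHardy p n m ψ f) ≤
      ∫⁻ t in ZpstarPi p m, (∏ i, lqNormSphere p n (qi i) k (fun x => f i (t i • x))) * ψ t
        ∂padicHaarPi p m :=
  lintegral_rpow_lintegral_prod_le ((padicHaarPi p n).restrict (padicSphere p n k))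
    ((padicHaarPi p m).restrict (ZpstarPi p m)) hq hqi hqsum
    (G := fun i x t => f i (t i • x)) (fun i => measurable_uncurry_comp_smul p i (hf i)) hψ

theorem measurableSet_ZpstarPi (m : ℕ) : MeasurableSet (ZpstarPi p m) :=
  MeasurableSet.univ_pi fun _ =>
    (measurableSet_singleton 0).compl.inter (measurableSet_le measurable_norm measurable_const)

theorem morreyHerzNorm_multilinearHardy_le {n m : ℕ} {αi lami ri qi : Fin m → ℝ} {r q : ℝ}
    (hr : 1 < r) (hq : 1 < q) (hri : ∀ i, 0 < ri i) (hqi : ∀ i, 0 < qi i)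
    (hrsum : ∑ i, (ri i)⁻¹ = r⁻¹) (hqsum : ∑ i, (qi i)⁻¹ = q⁻¹)
    {ψ : (Fin m → ℚ_[p]) → ℝ≥0∞} (hψ : Measurable ψ)
    {f : Fin m → (Fin n → ℚ_[p]) → ℝ≥0∞} (hf : ∀ i, Measurable (f i)) :
    morreyHerzNorm p n (∑ i, αi i) (∑ i, lami i) r q (multilinearHardy p n m ψ f) ≤
      (∫⁻ t in ZpstarPi p m,
        (∏ i, ENNReal.ofReal ‖t i‖ ^ (-(αi i + (n : ℝ) / qi i - lami i))) * ψ t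
          ∂padicHaarPi p m) *
        ∏ i, morreyHerzNorm p n (αi i) (lami i) (ri i) (qi i) (f i) := by
  have hr0 : 0 < r := by linarith
  have hpE : (p : ℝ≥0∞) ≠ 0 := by exact_mod_cast (Fact.out : p.Prime).ne_zero
  have hpT : (p : ℝ≥0∞) ≠ ⊤ := ENNReal.natCast_ne_top p
  have hprod : ∀ (c : ℝ) (a : Fin m → ℝ),
      ∏ i, (p : ℝ≥0∞) ^ (c * a i) = (p : ℝ≥0∞) ^ (c * ∑ i, a i) := fun c a => by
    rw [Finset.mul_sum]
    induction (Finset.univ : Finset (Fin m)) using Finset.cons_induction with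
    | empty => simp
    | cons i s hi ih => rw [Finset.prod_cons, Finset.sum_cons, ENNReal.rpow_add _ _ hpE hpT, ih]
  refine iSup_le fun k₀ => ?_
  set N : Fin m → ℝ≥0∞ := fun i => morreyHerzNorm p n (αi i) (lami i) (ri i) (qi i) (f i)
  set W : (Fin m → ℚ_[p]) → ℝ≥0∞ := fun t =>
    (∏ i, ENNReal.ofReal ‖t i‖ ^ (-(αi i + (n : ℝ) / qi i - lami i))) * ψ t with hW
  have hWm : Measurable W := by
    refine (Finset.measurable_fun_prod _ fun i _ => ?_).mul hψ
    exact ((measurable_pi_apply i).norm.ennreal_ofReal).pow_const _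
  set G : Fin m → {k : ℤ // k ≤ k₀} → (Fin m → ℚ_[p]) → ℝ≥0∞ := fun i k t =>
    (p : ℝ≥0∞) ^ (((k : ℤ) : ℝ) * αi i) * lqNormSphere p n (qi i) k (fun x => f i (t i • x))
    with hG
  have hGm : ∀ i k, Measurable (G i k) := fun i k =>
    (measurable_lqNormSphere_comp_smul p (qi i) k i (hf i)).const_mul _
  have hterm : ∀ k : {k : ℤ // k ≤ k₀}, (p : ℝ≥0∞) ^ (((k : ℤ) : ℝ) * (∑ i, αi i) * r) *
      lqNormSphere p n q k (multilinearHardy p n m ψ f) ^ r ≤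
        (∫⁻ t in ZpstarPi p m, (∏ i, G i k t) * ψ t ∂padicHaarPi p m) ^ r := fun k => by
    rw [ENNReal.rpow_mul, ← ENNReal.mul_rpow_of_nonneg _ _ hr0.le]
    refine ENNReal.rpow_le_rpow ?_ hr0.le
    refine (mul_le_mul_right (lqNormSphere_multilinearHardy_le p hq hqi hqsum hψ hf k) _).trans_eq ?_
    rw [← lintegral_const_mul' _ _ (ENNReal.rpow_ne_top_of_ne_zero hpE hpT)]
    refine lintegral_congr fun t => ?_
    simp only [hG]
    rw [Finset.prod_mul_distrib, hprod, mul_assoc]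
  have hsum : (∑' k : {k : ℤ // k ≤ k₀}, (p : ℝ≥0∞) ^ (((k : ℤ) : ℝ) * (∑ i, αi i) * r) *
      lqNormSphere p n q k (multilinearHardy p n m ψ f) ^ r) ^ (1 / r) ≤
        (p : ℝ≥0∞) ^ ((k₀ : ℝ) * ∑ i, lami i) *
          ((∫⁻ t in ZpstarPi p m, W t ∂padicHaarPi p m) * ∏ i, N i) := by
    calc _ ≤ (∑' k : {k : ℤ // k ≤ k₀},
            (∫⁻ t in ZpstarPi p m, (∏ i, G i k t) * ψ t ∂padicHaarPi p m) ^ r) ^ (1 / r) :=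
          ENNReal.rpow_le_rpow (ENNReal.tsum_le_tsum hterm) (one_div_nonneg.2 hr0.le)
      _ ≤ ∫⁻ t in ZpstarPi p m, (∏ i, (∑' k, G i k t ^ ri i) ^ (1 / ri i)) * ψ t
            ∂padicHaarPi p m := by
          have h := lintegral_rpow_lintegral_prod_le (Measure.count (α := {k : ℤ // k ≤ k₀}))
            ((padicHaarPi p m).restrict (ZpstarPi p m)) hr hri hrsum (G := G)
            (fun i => measurable_from_prod_countable_right (hGm i)) hψ
          simpa only [lintegral_count] using h
      _ ≤ ∫⁻ t in ZpstarPi p m, W t * ((p : ℝ≥0∞) ^ ((k₀ : ℝ) * ∑ i, lami i) * ∏ i, N i)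
            ∂padicHaarPi p m := by
          refine setLIntegral_mono' (measurableSet_ZpstarPi p m) fun t ht => ?_
          rw [← hprod, ← Finset.prod_mul_distrib]
          simp only [hW]
          rw [mul_right_comm, ← Finset.prod_mul_distrib]
          gcongr with i
          exact tsum_lqNormSphere_comp_smul_le p (hri i) (hqi i) k₀ (ht i trivial).1 (hf i)
      _ = _ := by
          rw [lintegral_mul_const _ hWm]
          ring
  refine (mul_le_mul_right hsum _).trans_eq ?_
  rw [← mul_assoc, ← ENNReal.rpow_add _ _ hpE hpT]
  simp

/-- Sufficiency part of Theorem 3.1: if the weight integral `C` is finite, then the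
weighted multilinear p-adic Hardy operator is bounded on the product of Morrey–Herz
spaces, with operator norm at most `C`. -/
theorem statement4 (p n m : ℕ) [Fact p.Prime] (hn : 1 ≤ n) (hm : 1 ≤ m)
    (α : ℝ) (αi : Fin m → ℝ) (lam : ℝ) (lami : Fin m → ℝ)
    (r q : ℝ) (ri qi : Fin m → ℝ)
    (hlam : 0 < lam) (hlami : ∀ i, 0 < lami i)
    (hr : 1 < r) (hq : 1 < q) (hri : ∀ i, 1 < ri i) (hqi : ∀ i, 1 < qi i)
    (hα : ∑ i, αi i = α) (hrsum : ∑ i, (ri i)⁻¹ = r⁻¹) (hqsum : ∑ i, (qi i)⁻¹ = q⁻¹)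
    (hlamsum : ∑ i, lami i = lam)
    (ψ : (Fin m → ℚ_[p]) → ℝ≥0∞) (hψ : Measurable ψ)
    (C : ℝ≥0∞)
    (hC : C = ∫⁻ t in ZpstarPi p m,
        (∏ i, ENNReal.ofReal ‖t i‖ ^ (-(αi i + (n : ℝ) / qi i - lami i))) * ψ t
          ∂ padicHaarPi p m)
    (hCfin : C ≠ ⊤) :
    (∀ f : Fin m → (Fin n → ℚ_[p]) → ℝ≥0∞, (∀ i, Measurable (f i)) →
        morreyHerzNorm p n α lam r q (multilinearHardy p n m ψ f)
          ≤ C * ∏ i, morreyHerzNorm p n (αi i) (lami i) (ri i) (qi i) (f i)) ∧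
      sInf {D : ℝ≥0∞ | ∀ f : Fin m → (Fin n → ℚ_[p]) → ℝ≥0∞, (∀ i, Measurable (f i)) →
        morreyHerzNorm p n α lam r q (multilinearHardy p n m ψ f)
          ≤ D * ∏ i, morreyHerzNorm p n (αi i) (lami i) (ri i) (qi i) (f i)} ≤ C := by
  subst hα hlamsum hC
  have h := fun f hf => morreyHerzNorm_multilinearHardy_le p (n := n) (αi := αi) (lami := lami) hr
    hq (fun i => one_pos.trans (hri i)) (fun i => one_pos.trans (hqi i)) hrsum hqsum hψ (f := f) hf
  exact ⟨h, sInf_le h⟩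

end
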